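/- For any tetrahedron, rad(T) ≤ Rad(T) < 2 · rad(T), i.e. the ratio Rad(T)/rad(T) lies in [1, 2). -/

import Mathlib

open scoped ENNReal

/-- The intrinsic (geodesic) distance on a subset `T` of `ℝ³`: the infimum of the lengths of
continuous paths from `x` to `y` staying in `T`. -/
noncomputable def rho (T : Set (EuclideanSpace ℝ (Fin 3)))
    (x y : EuclideanSpace ℝ (Fin 3)) : ℝ≥0∞ :=
  ⨅ (γ : ℝ → EuclideanSpace ℝ (Fin 3)) (_ : Continuous γ) (_ : γ 0 = x) (_ : γ 1 = y)
    (_ : ∀ t ∈ Set.Icc (0 : ℝ) 1, γ t ∈ T), eVariationOn γ (Set.Icc 0 1)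

/-- Intrinsic diameter. -/
noncomputable def intrinsicDiam (T : Set (EuclideanSpace ℝ (Fin 3))) : ℝ≥0∞ :=
  ⨆ x ∈ T, ⨆ y ∈ T, rho T x y

/-- Intrinsic radius. -/
noncomputable def intrinsicRad (T : Set (EuclideanSpace ℝ (Fin 3))) : ℝ≥0∞ :=
  ⨅ x ∈ T, ⨆ y ∈ T, rho T x y

/-- Extrinsic radius. -/
noncomputable def extrinsicRad (T : Set (EuclideanSpace ℝ (Fin 3))) : ℝ≥0∞ :=
  ⨅ x ∈ T, ⨆ y ∈ T, edist x y

/-! ### Comparison of the intrinsic and the extrinsic distance -/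

lemma edist_le_rho (T : Set (EuclideanSpace ℝ (Fin 3))) (x y : EuclideanSpace ℝ (Fin 3)) :
    edist x y ≤ rho T x y := by
  refine le_iInf fun γ => le_iInf fun _ => le_iInf fun h0 => le_iInf fun h1 => le_iInf fun _ => ?_
  rw [← h0, ← h1]
  exact eVariationOn.edist_le γ (by simp) (by simp)

lemma extrinsicRad_le_intrinsicRad (T : Set (EuclideanSpace ℝ (Fin 3))) :
    extrinsicRad T ≤ intrinsicRad T :=
  iInf₂_mono fun x _ => iSup₂_mono fun y _ => edist_le_rho T x y

lemma eVariationOn_lineMap_comp_le (x y : EuclideanSpace ℝ (Fin 3)) {u : ℝ → ℝ} (hu : Monotone u)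
    {s t : ℝ} (hst : s ≤ t) :
    eVariationOn (AffineMap.lineMap x y ∘ u : ℝ → EuclideanSpace ℝ (Fin 3)) (Set.Icc s t) ≤
      edist x y * ENNReal.ofReal (u t - u s) := by
  have h := (lipschitzWith_lineMap (𝕜 := ℝ) x y).lipschitzOnWith (s := Set.univ)
    |>.comp_eVariationOn_le (g := u) (s := Set.Icc s t) (Set.mapsTo_univ _ _)
  have h' := (hu.monotoneOn (Set.Icc s t)).eVariationOn_eq (Set.left_mem_Icc.2 hst)
    (Set.right_mem_Icc.2 hst)
  rw [Set.inter_self] at h'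
  rwa [h', ← edist_nndist] at h

/-- A path made of two segments contained in `T` bounds the intrinsic distance. -/
lemma rho_le_edist_add_edist {T : Set (EuclideanSpace ℝ (Fin 3))}
    {x p y : EuclideanSpace ℝ (Fin 3)} (hxp : segment ℝ x p ⊆ T) (hpy : segment ℝ p y ⊆ T) :
    rho T x y ≤ edist x p + edist p y := by
  let f : ℝ → EuclideanSpace ℝ (Fin 3) := AffineMap.lineMap x p ∘ fun t => 2 * t
  let g : ℝ → EuclideanSpace ℝ (Fin 3) := AffineMap.lineMap p y ∘ fun t => 2 * t - 1
  let γ : ℝ → EuclideanSpace ℝ (Fin 3) := fun t => if t ≤ 1 / 2 then f t else g t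
  have hfg : f (1 / 2) = g (1 / 2) := by simp [f, g]
  have hγf : Set.EqOn γ f (Set.Icc 0 (1 / 2)) := fun t ht => if_pos ht.2
  have hγg : Set.EqOn γ g (Set.Icc (1 / 2) 1) := fun t ht => by
    rcases ht.1.eq_or_lt with h | h
    · simp only [γ, ← h, le_refl, if_true, hfg]
    · exact if_neg (not_le.2 h)
  have hcont : Continuous γ := by
    refine Continuous.if_le ?_ ?_ continuous_id continuous_const ?_
    · exact AffineMap.lineMap_continuous.comp (by fun_prop)
    · exact AffineMap.lineMap_continuous.comp (by fun_prop)
    · rintro t rfl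
      exact hfg
  have hmem : ∀ t ∈ Set.Icc (0 : ℝ) 1, γ t ∈ T := by
    intro t ht
    rcases le_total t (1 / 2) with h | h
    · rw [hγf ⟨ht.1, h⟩]
      apply hxp
      rw [segment_eq_image_lineMap]
      exact ⟨2 * t, ⟨by linarith [ht.1], by linarith⟩, rfl⟩
    · rw [hγg ⟨h, ht.2⟩]
      apply hpy
      rw [segment_eq_image_lineMap]
      exact ⟨2 * t - 1, ⟨by linarith, by linarith [ht.2]⟩, rfl⟩
  have h0 : γ 0 = x := by rw [hγf (by norm_num)]; simp [f]
  have h1 : γ 1 = y := by rw [hγg (by norm_num)]; norm_num [g]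
  have hle : rho T x y ≤ eVariationOn γ (Set.Icc 0 1) :=
    (iInf_le _ γ).trans <| (iInf_le _ hcont).trans <| (iInf_le _ h0).trans <|
      (iInf_le _ h1).trans <| iInf_le _ hmem
  refine hle.trans ?_
  have hsplit := eVariationOn.Icc_add_Icc γ (s := Set.univ) (a := 0) (b := 1 / 2) (c := 1)
    (by norm_num) (by norm_num) (Set.mem_univ _)
  simp only [Set.univ_inter] at hsplit
  rw [← hsplit, eVariationOn.eq_of_eqOn hγf, eVariationOn.eq_of_eqOn hγg]
  refine add_le_add ?_ ?_
  · refine (eVariationOn_lineMap_comp_le x p (u := fun t => 2 * t)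
      (fun s t h => by dsimp only; linarith) (by norm_num)).trans ?_
    norm_num
  · refine (eVariationOn_lineMap_comp_le p y (u := fun t => 2 * t - 1)
      (fun s t h => by dsimp only; linarith) (by norm_num)).trans ?_
    norm_num

/-! ### Points of a triangle -/

lemma exists_weights_of_mem_convexHull_triple {b c d y : EuclideanSpace ℝ (Fin 3)}
    (hy : y ∈ convexHull ℝ {b, c, d}) :
    ∃ β γ δ : ℝ, 0 ≤ β ∧ 0 ≤ γ ∧ 0 ≤ δ ∧ β + γ + δ = 1 ∧ y = β • b + γ • c + δ • d := by
  rw [convexHull_insert (by simp), convexHull_pair] at hy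
  simp only [convexJoin_singleton_left, Set.mem_iUnion] at hy
  obtain ⟨z, ⟨s, t, hs, ht, hst, rfl⟩, ⟨u, v, hu, hv, huv, rfl⟩⟩ := hy
  refine ⟨u, v * s, v * t, hu, by positivity, by positivity, ?_, ?_⟩
  · linear_combination huv + v * hst
  · module

lemma weights_mem_convexHull_triple {b c d : EuclideanSpace ℝ (Fin 3)} {β γ δ : ℝ}
    (hβ : 0 ≤ β) (hγ : 0 ≤ γ) (hδ : 0 ≤ δ) (h : β + γ + δ = 1) :
    β • b + γ • c + δ • d ∈ convexHull ℝ {b, c, d} := by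
  have := (convex_convexHull ℝ ({b, c, d} : Set (EuclideanSpace ℝ (Fin 3)))).sum_mem
    (t := Finset.univ) (w := ![β, γ, δ]) (z := ![b, c, d])
    (by intro i _; fin_cases i <;> simpa)
    (by simpa [Fin.sum_univ_three] using h)
    (by intro i _; apply subset_convexHull; fin_cases i <;> simp)
  simpa [Fin.sum_univ_three] using this

lemma segment_midpoint_subset {a b c y : EuclideanSpace ℝ (Fin 3)}
    (hy : y ∈ convexHull ℝ {a, b, c}) :
    segment ℝ (midpoint ℝ a b) y ⊆ convexHull ℝ {a, b, c} := by
  refine (convex_convexHull ℝ _).segment_subset ?_ hy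
  exact (convex_convexHull ℝ _).midpoint_mem (subset_convexHull _ _ (by simp))
    (subset_convexHull _ _ (by simp))

/-- Points of a face adjacent to the edge `ab` are close to the midpoint of `ab`. -/
lemma rho_midpoint_le_of_mem_adjacent {T : Set (EuclideanSpace ℝ (Fin 3))}
    {a b c y : EuclideanSpace ℝ (Fin 3)} {M : ℝ} (hT : convexHull ℝ {a, b, c} ⊆ T)
    (hab : dist a b ≤ 2 * M) (hac : dist a c + dist b c ≤ 2 * M)
    (hy : y ∈ convexHull ℝ {a, b, c}) :
    rho T (midpoint ℝ a b) y ≤ ENNReal.ofReal M := by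
  have hseg := (segment_midpoint_subset hy).trans hT
  refine (rho_le_edist_add_edist hseg (by simpa using hseg (right_mem_segment ℝ _ _))).trans ?_
  rw [edist_self, add_zero, edist_dist]
  refine ENNReal.ofReal_le_ofReal ?_
  have hball : convexHull ℝ {a, b, c} ⊆ Metric.closedBall (midpoint ℝ a b) M := by
    refine convexHull_min ?_ (convex_closedBall _ _)
    rintro z (rfl | rfl | rfl)
    · rw [Metric.mem_closedBall, dist_left_midpoint]
      norm_num; linarith
    · rw [Metric.mem_closedBall, dist_right_midpoint]
      norm_num; linarith
    · have := dist_midpoint_midpoint_le a b z z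
      rw [midpoint_self, dist_comm] at this
      rw [Metric.mem_closedBall]
      linarith
  rw [dist_comm]
  exact hball hy

/-- Points of the half of the opposite-to-`a` face lying on the side of `c` can be reached from the
midpoint of `ab` by crossing the edge `bc` after moving along the direction of `bd`. -/
lemma rho_midpoint_le_of_weights {T : Set (EuclideanSpace ℝ (Fin 3))}
    {a b c d : EuclideanSpace ℝ (Fin 3)} {M : ℝ}
    (habc : convexHull ℝ {a, b, c} ⊆ T) (hbcd : convexHull ℝ {b, c, d} ⊆ T)
    (hab : dist a b ≤ 2 * M) (hac : dist a c + dist b c ≤ 2 * M)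
    (hacbd : dist a c + dist b d ≤ 2 * M)
    {β γ δ : ℝ} (hβ : 0 ≤ β) (hδ : 0 ≤ δ) (hγ : δ ≤ γ) (h1 : β + γ + δ = 1) :
    rho T (midpoint ℝ a b) (β • b + γ • c + δ • d) ≤ ENNReal.ofReal M := by
  set y := β • b + γ • c + δ • d with hydef
  set m := midpoint ℝ a b with hm
  set p := (β + δ) • b + γ • c with hp
  have hγ0 : 0 ≤ γ := hδ.trans hγ
  have hpabc : p ∈ convexHull ℝ {a, b, c} := by
    have := weights_mem_convexHull_triple (b := a) (c := b) (d := c) le_rfl (add_nonneg hβ hδ) hγ0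
      (by linarith)
    simpa [hp] using this
  have hpbcd : p ∈ convexHull ℝ {b, c, d} := by
    have := weights_mem_convexHull_triple (b := b) (c := c) (d := d) (add_nonneg hβ hδ) hγ0 le_rfl
      (by linarith)
    simpa [hp] using this
  have hy : y ∈ convexHull ℝ {b, c, d} := weights_mem_convexHull_triple hβ hγ0 hδ h1
  refine (rho_le_edist_add_edist ((segment_midpoint_subset hpabc).trans habc)
    (((convex_convexHull ℝ _).segment_subset hpbcd hy).trans hbcd)).trans ?_
  rw [edist_dist, edist_dist, ← ENNReal.ofReal_add dist_nonneg dist_nonneg]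
  refine ENNReal.ofReal_le_ofReal ?_
  have hmv : m = (1 / 2 : ℝ) • a + (1 / 2 : ℝ) • b := by
    rw [hm, midpoint_eq_smul_add]; norm_num
  have e1 : m - p = (β / 2) • (a - b) + ((γ - δ) / 2) • ((a - c) + (b - c)) + δ • (a - c) := by
    have hβ' : β = 1 - γ - δ := by linarith
    rw [hp, hmv, hβ']
    module
  have e2 : p - y = δ • (b - d) := by
    rw [hp, hydef]
    module
  have n1 : dist m p ≤ β / 2 * dist a b + (γ - δ) / 2 * (dist a c + dist b c) + δ * dist a c := by
    simp only [dist_eq_norm]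
    rw [e1]
    refine (norm_add₃_le).trans ?_
    rw [norm_smul_of_nonneg (by linarith), norm_smul_of_nonneg (by linarith),
      norm_smul_of_nonneg hδ]
    have := norm_add_le (a - c) (b - c)
    have := mul_le_mul_of_nonneg_left this (show 0 ≤ (γ - δ) / 2 by linarith)
    linarith
  have n2 : dist p y = δ * dist b d := by
    simp only [dist_eq_norm]
    rw [e2, norm_smul_of_nonneg hδ]
  have k1 := mul_le_mul_of_nonneg_left hab (show 0 ≤ β / 2 by linarith)
  have k2 := mul_le_mul_of_nonneg_left hac (show 0 ≤ (γ - δ) / 2 by linarith)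
  have k3 := mul_le_mul_of_nonneg_left hacbd hδ
  have k4 : M = β * M + γ * M + δ * M := by linear_combination (-M) * h1
  linarith

lemma rho_midpoint_le_of_mem_opposite {T : Set (EuclideanSpace ℝ (Fin 3))}
    {a b c d y : EuclideanSpace ℝ (Fin 3)} {M : ℝ}
    (habc : convexHull ℝ {a, b, c} ⊆ T) (habd : convexHull ℝ {a, b, d} ⊆ T)
    (hbcd : convexHull ℝ {b, c, d} ⊆ T)
    (hab : dist a b ≤ 2 * M) (hac : dist a c + dist b c ≤ 2 * M)
    (had : dist a d + dist b d ≤ 2 * M)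
    (hacbd : dist a c + dist b d ≤ 2 * M) (hadbc : dist a d + dist b c ≤ 2 * M)
    (hy : y ∈ convexHull ℝ {b, c, d}) :
    rho T (midpoint ℝ a b) y ≤ ENNReal.ofReal M := by
  obtain ⟨β, γ, δ, hβ, hγ, hδ, h1, rfl⟩ := exists_weights_of_mem_convexHull_triple hy
  rcases le_total δ γ with h | h
  · exact rho_midpoint_le_of_weights habc hbcd hab hac hacbd hβ hδ h h1
  · rw [add_right_comm]
    rw [Set.pair_comm] at hbcd
    exact rho_midpoint_le_of_weights habd hbcd hab had hadbc hβ hγ h (by linarith)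

/-! ### The surface as a union of four triangles -/

/-- `T` is the union of the four triangles spanned by the points `a`, `b`, `c`, `d`. -/
def IsFourTriangles (T : Set (EuclideanSpace ℝ (Fin 3))) (a b c d : EuclideanSpace ℝ (Fin 3)) :
    Prop :=
  T = convexHull ℝ {a, b, c} ∪ convexHull ℝ {a, b, d} ∪ convexHull ℝ {a, c, d} ∪
    convexHull ℝ {b, c, d}

namespace IsFourTriangles

variable {T : Set (EuclideanSpace ℝ (Fin 3))} {a b c d : EuclideanSpace ℝ (Fin 3)}

lemma swap_left (h : IsFourTriangles T a b c d) : IsFourTriangles T b a c d := by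
  rw [IsFourTriangles] at h ⊢
  rw [h, Set.insert_comm a b, Set.insert_comm a b]
  ext y
  simp only [Set.mem_union]
  tauto

lemma swap_middle (h : IsFourTriangles T a b c d) : IsFourTriangles T a c b d := by
  rw [IsFourTriangles] at h ⊢
  rw [h, Set.pair_comm b c, Set.insert_comm b c]
  ext y
  simp only [Set.mem_union]
  tauto

lemma swap_right (h : IsFourTriangles T a b c d) : IsFourTriangles T a b d c := by
  rw [IsFourTriangles] at h ⊢
  rw [h, Set.pair_comm c d]
  ext y
  simp only [Set.mem_union]
  tauto

lemma mem_left (h : IsFourTriangles T a b c d) : a ∈ T := by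
  rw [h]
  exact Or.inl (Or.inl (Or.inl (subset_convexHull _ _ (by simp))))

lemma intrinsicRad_le (h : IsFourTriangles T a b c d) {M : ℝ}
    (hab : dist a b ≤ 2 * M) (hac : dist a c + dist b c ≤ 2 * M)
    (had : dist a d + dist b d ≤ 2 * M)
    (hacbd : dist a c + dist b d ≤ 2 * M) (hadbc : dist a d + dist b c ≤ 2 * M) :
    intrinsicRad T ≤ ENNReal.ofReal M := by
  have habc : convexHull ℝ {a, b, c} ⊆ T := by
    rw [h]; exact fun y hy => Or.inl (Or.inl (Or.inl hy))
  have habd : convexHull ℝ {a, b, d} ⊆ T := by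
    rw [h]; exact fun y hy => Or.inl (Or.inl (Or.inr hy))
  have hacd : convexHull ℝ {a, c, d} ⊆ T := by
    rw [h]; exact fun y hy => Or.inl (Or.inr hy)
  have hbcd : convexHull ℝ {b, c, d} ⊆ T := by
    rw [h]; exact fun y hy => Or.inr hy
  have hm : midpoint ℝ a b ∈ T :=
    habc (segment_midpoint_subset (subset_convexHull _ _ (by simp : a ∈ ({a, b, c} : Set _)))
      (left_mem_segment ℝ _ _))
  refine iInf₂_le_of_le _ hm (iSup₂_le fun y hy => ?_)
  rw [h] at hy
  rcases hy with ((hy | hy) | hy) | hy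
  · exact rho_midpoint_le_of_mem_adjacent habc hab hac hy
  · exact rho_midpoint_le_of_mem_adjacent habd hab had hy
  · rw [Set.insert_comm] at habc habd
    rw [midpoint_comm]
    exact rho_midpoint_le_of_mem_opposite habc habd hacd (by rwa [dist_comm]) (by linarith)
      (by linarith) (by linarith) (by linarith) hy
  · exact rho_midpoint_le_of_mem_opposite habc habd hbcd hab hac had hacbd hadbc hy

end IsFourTriangles

/-! ### Lower bounds for the extrinsic radius -/

lemma ofReal_half_dist_le_extrinsicRad {T : Set (EuclideanSpace ℝ (Fin 3))}
    {a b : EuclideanSpace ℝ (Fin 3)} (ha : a ∈ T) (hb : b ∈ T) :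
    ENNReal.ofReal (dist a b / 2) ≤ extrinsicRad T := by
  refine le_iInf₂ fun x _ => ?_
  have h := dist_triangle_left a b x
  rcases le_total (dist a b / 2) (dist x a) with h' | h'
  · refine le_trans ?_ (le_iSup₂ (f := fun y (_ : y ∈ T) => edist x y) a ha)
    rw [edist_dist]
    exact ENNReal.ofReal_le_ofReal h'
  · refine le_trans ?_ (le_iSup₂ (f := fun y (_ : y ∈ T) => edist x y) b hb)
    rw [edist_dist]
    exact ENNReal.ofReal_le_ofReal (by linarith)

/-- Two distinct equally long segments with a common endpoint do not fit into a ball having their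
length as diameter. -/
lemma ofReal_half_dist_lt_extrinsicRad {T : Set (EuclideanSpace ℝ (Fin 3))}
    {a b c : EuclideanSpace ℝ (Fin 3)} (ha : a ∈ T) (hb : b ∈ T) (hc : c ∈ T) (hbc : b ≠ c)
    (h : dist a c = dist a b) :
    ENNReal.ofReal (dist a b / 2) < extrinsicRad T := by
  set L := dist a b with hL
  set e := dist b c with he
  have he0 : 0 < e := dist_pos.2 hbc
  have hL0 : 0 ≤ L := dist_nonneg
  set R := √((L / 2) ^ 2 + (e / 4) ^ 2) with hR
  have hR2 : R ^ 2 = (L / 2) ^ 2 + (e / 4) ^ 2 := Real.sq_sqrt (by positivity)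
  have hLR : L / 2 < R := Real.lt_sqrt_of_sq_lt (by nlinarith)
  have hR0 : 0 < R := by linarith
  refine ((ENNReal.ofReal_lt_ofReal_iff hR0).2 hLR).trans_le (le_iInf₂ fun x _ => ?_)
  suffices ∃ y ∈ T, R ≤ dist x y by
    obtain ⟨y, hy, hxy⟩ := this
    refine le_trans ?_ (le_iSup₂ (f := fun y (_ : y ∈ T) => edist x y) y hy)
    rw [edist_dist]
    exact ENNReal.ofReal_le_ofReal hxy
  by_contra! hcon
  have parallelogram : ∀ z : EuclideanSpace ℝ (Fin 3), dist a z = L → dist x z < R →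
      (2 * dist x (midpoint ℝ a z)) ^ 2 < (e / 2) ^ 2 := by
    intro z haz hxz
    have hxa := hcon a ha
    have key := parallelogram_law_with_norm ℝ (x - a) (x - z)
    have e1 : (x - a) + (x - z) = (2 : ℝ) • (x - midpoint ℝ a z) := by
      rw [midpoint_eq_smul_add, smul_sub, smul_smul]
      norm_num
      module
    have e2 : (x - a) - (x - z) = z - a := by abel
    rw [e1, e2, norm_smul, ← dist_eq_norm, ← dist_eq_norm, ← dist_eq_norm, ← dist_eq_norm,
      dist_comm z a, haz] at key
    norm_num at key
    have h1 : dist x a ^ 2 < R ^ 2 := by gcongr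
    have h2 : dist x z ^ 2 < R ^ 2 := by gcongr
    nlinarith
  have hb' := abs_lt_of_sq_lt_sq (parallelogram b rfl (hcon b hb)) (by positivity)
  have hc' := abs_lt_of_sq_lt_sq (parallelogram c h (hcon c hc)) (by positivity)
  have hmm : dist (midpoint ℝ a b) (midpoint ℝ a c) = e / 2 := by
    rw [dist_eq_norm, midpoint_eq_smul_add, midpoint_eq_smul_add, ← smul_sub, add_sub_add_left_eq_sub,
      norm_smul, ← dist_eq_norm]
    norm_num
    ring
  have := dist_triangle_left (midpoint ℝ a b) (midpoint ℝ a c) x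
  linarith [le_abs_self (2 * dist x (midpoint ℝ a b)), le_abs_self (2 * dist x (midpoint ℝ a c))]

lemma IsFourTriangles.intrinsicRad_lt {T : Set (EuclideanSpace ℝ (Fin 3))}
    {a b c d : EuclideanSpace ℝ (Fin 3)} (h : IsFourTriangles T a b c d)
    (hab : a ≠ b) (hbc : b ≠ c) (hbd : b ≠ d)
    (hac' : dist a c ≤ dist a b) (had' : dist a d ≤ dist a b) (hbc' : dist b c ≤ dist a b)
    (hbd' : dist b d ≤ dist a b) :
    intrinsicRad T < 2 * extrinsicRad T := by
  have ha := h.mem_left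
  have hb := h.swap_left.mem_left
  have hc := h.swap_middle.swap_left.mem_left
  have hd := h.swap_right.swap_middle.swap_left.mem_left
  have hL : 0 < dist a b := dist_pos.2 hab
  have htwo : ENNReal.ofReal (dist a b) = 2 * ENNReal.ofReal (dist a b / 2) := by
    rw [two_mul, ← ENNReal.ofReal_add (by linarith) (by linarith), add_halves]
  have hle : intrinsicRad T ≤ ENNReal.ofReal (dist a b) :=
    h.intrinsicRad_le (by linarith) (by linarith) (by linarith) (by linarith) (by linarith)
  have hstrict : ENNReal.ofReal (dist a b / 2) < extrinsicRad T →
      intrinsicRad T < 2 * extrinsicRad T := fun hlt => by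
    refine hle.trans_lt ?_
    rw [htwo]
    exact (ENNReal.mul_lt_mul_iff_right (by norm_num) (by norm_num)).2 hlt
  rcases hac'.eq_or_lt with hac | hac
  · exact hstrict (ofReal_half_dist_lt_extrinsicRad ha hb hc hbc hac)
  rcases had'.eq_or_lt with had | had
  · exact hstrict (ofReal_half_dist_lt_extrinsicRad ha hb hd hbd had)
  obtain ⟨M, hM, hML⟩ : ∃ M, (max (dist a c) (dist a d) + dist a b) / 2 ≤ M ∧ M < dist a b :=
    ⟨_, le_rfl, by linarith [max_lt hac had]⟩
  have h1 := le_max_left (dist a c) (dist a d)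
  have h2 := le_max_right (dist a c) (dist a d)
  have h3 : 0 ≤ dist a c := dist_nonneg
  have hlt : intrinsicRad T < ENNReal.ofReal (dist a b) :=
    (h.intrinsicRad_le (M := M) (by linarith) (by linarith) (by linarith) (by linarith)
      (by linarith)).trans_lt ((ENNReal.ofReal_lt_ofReal_iff hL).2 hML)
  refine hlt.trans_le ?_
  rw [htwo]
  gcongr
  exact ofReal_half_dist_le_extrinsicRad ha hb

/-! ### The frontier of a tetrahedron -/

lemma isFourTriangles_frontier_convexHull {a b c d : EuclideanSpace ℝ (Fin 3)}
    (hind : AffineIndependent ℝ ![a, b, c, d]) :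
    IsFourTriangles (frontier (convexHull ℝ {a, b, c, d})) a b c d := by
  let B : AffineBasis (Fin 4) ℝ (EuclideanSpace ℝ (Fin 3)) :=
    ⟨![a, b, c, d], hind, by
      rw [hind.affineSpan_eq_top_iff_card_eq_finrank_add_one]; simp⟩
  have hB : (B : Fin 4 → EuclideanSpace ℝ (Fin 3)) = ![a, b, c, d] := rfl
  have hrange : Set.range B = {a, b, c, d} := by
    rw [hB]
    ext y
    simp only [Set.mem_range, Fin.exists_fin_succ]
    simp [eq_comm]
  have hfr : ∀ y, y ∈ frontier (convexHull ℝ {a, b, c, d}) ↔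
      (∀ i, 0 ≤ B.coord i y) ∧ ∃ i, B.coord i y = 0 := by
    intro y
    rw [((Set.toFinite ({a, b, c, d} : Set (EuclideanSpace ℝ (Fin 3)))).isClosed_convexHull
      ℝ).frontier_eq, ← hrange, B.interior_convexHull, B.convexHull_eq_nonneg_coord]
    simp only [Set.mem_sdiff, Set.mem_ofPred_eq, not_forall, not_lt]
    exact and_congr_right fun h => exists_congr fun i => ⟨fun h' => le_antisymm h' (h i), le_of_eq⟩
  have hface : ∀ i, ∀ s : Set (EuclideanSpace ℝ (Fin 3)), (∀ z ∈ s, ∃ j, j ≠ i ∧ B j = z) →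
      convexHull ℝ s ⊆ frontier (convexHull ℝ {a, b, c, d}) := by
    intro i s hs
    have hconv : Convex ℝ {y | (∀ j, 0 ≤ B.coord j y) ∧ B.coord i y = 0} := by
      rw [Set.ofPred_and, Set.ofPred_forall]
      exact (convex_iInter fun j => (convex_Ici (0 : ℝ)).affine_preimage (B.coord j)).inter
        ((convex_singleton (0 : ℝ)).affine_preimage (B.coord i))
    refine (convexHull_min ?_ hconv).trans fun y hy => (hfr y).2 ⟨hy.1, i, hy.2⟩
    intro z hz
    obtain ⟨j, hj, rfl⟩ := hs z hz
    refine ⟨fun k => ?_, B.coord_apply_ne hj.symm⟩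
    rw [B.coord_apply]
    split_ifs <;> norm_num
  rw [IsFourTriangles]
  refine Set.Subset.antisymm (fun y hy => ?_) ?_
  · obtain ⟨hnn, i, hi⟩ := (hfr y).1 hy
    have hsum := B.sum_coord_apply_eq_one y
    have hy' := B.linear_combination_coord_eq_self y
    rw [Fin.sum_univ_four] at hsum hy'
    have hb0 : B 0 = a := rfl
    have hb1 : B 1 = b := rfl
    have hb2 : B 2 = c := rfl
    have hb3 : B 3 = d := rfl
    rw [hb0, hb1, hb2, hb3] at hy'
    rw [← hy']
    fin_cases i <;> simp only [Fin.zero_eta, Fin.mk_one, Fin.reduceFinMk] at hi <;>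
      simp only [hi, zero_smul, zero_add, add_zero] at hsum ⊢
    · exact Or.inr (weights_mem_convexHull_triple (hnn _) (hnn _) (hnn _) hsum)
    · exact Or.inl (Or.inr (weights_mem_convexHull_triple (hnn _) (hnn _) (hnn _) hsum))
    · exact Or.inl (Or.inl (Or.inr (weights_mem_convexHull_triple (hnn _) (hnn _) (hnn _) hsum)))
    · exact Or.inl (Or.inl (Or.inl (weights_mem_convexHull_triple (hnn _) (hnn _) (hnn _) hsum)))
  · refine Set.union_subset (Set.union_subset (Set.union_subset (hface 3 _ ?_) (hface 2 _ ?_))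
      (hface 1 _ ?_)) (hface 0 _ ?_)
    · rintro z (rfl | rfl | rfl)
      exacts [⟨0, by decide, rfl⟩, ⟨1, by decide, rfl⟩, ⟨2, by decide, rfl⟩]
    · rintro z (rfl | rfl | rfl)
      exacts [⟨0, by decide, rfl⟩, ⟨1, by decide, rfl⟩, ⟨3, by decide, rfl⟩]
    · rintro z (rfl | rfl | rfl)
      exacts [⟨0, by decide, rfl⟩, ⟨2, by decide, rfl⟩, ⟨3, by decide, rfl⟩]
    · rintro z (rfl | rfl | rfl)
      exacts [⟨1, by decide, rfl⟩, ⟨2, by decide, rfl⟩, ⟨3, by decide, rfl⟩]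

theorem stmt6 (a b c d : EuclideanSpace ℝ (Fin 3))
    (hind : AffineIndependent ℝ ![a, b, c, d])
    (T : Set (EuclideanSpace ℝ (Fin 3)))
    (hT : T = frontier (convexHull ℝ ({a, b, c, d} : Set (EuclideanSpace ℝ (Fin 3))))) :
    extrinsicRad T ≤ intrinsicRad T ∧ intrinsicRad T < 2 * extrinsicRad T := by
  refine ⟨extrinsicRad_le_intrinsicRad T, ?_⟩
  have h : IsFourTriangles T a b c d := hT ▸ isFourTriangles_frontier_convexHull hind
  have hne : ∀ i j : Fin 4, i ≠ j → ![a, b, c, d] i ≠ ![a, b, c, d] j :=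
    fun i j hij => hind.injective.ne hij
  have hab : a ≠ b := hne 0 1 (by decide)
  have hac : a ≠ c := hne 0 2 (by decide)
  have had : a ≠ d := hne 0 3 (by decide)
  have hbc : b ≠ c := hne 1 2 (by decide)
  have hbd : b ≠ d := hne 1 3 (by decide)
  have hcd : c ≠ d := hne 2 3 (by decide)
  obtain ⟨i, hi, hmax⟩ := Finset.exists_max_image Finset.univ
    ![dist a b, dist a c, dist a d, dist b c, dist b d, dist c d] Finset.univ_nonempty
  have m0 := hmax 0 (Finset.mem_univ _)
  have m1 := hmax 1 (Finset.mem_univ _)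
  have m2 := hmax 2 (Finset.mem_univ _)
  have m3 := hmax 3 (Finset.mem_univ _)
  have m4 := hmax 4 (Finset.mem_univ _)
  have m5 := hmax 5 (Finset.mem_univ _)
  clear hmax hi
  have s1 := dist_comm b a
  have s2 := dist_comm c a
  have s3 := dist_comm d a
  have s4 := dist_comm c b
  have s5 := dist_comm d b
  have s6 := dist_comm d c
  fin_cases i <;> simp at m0 m1 m2 m3 m4 m5
  · apply h.intrinsicRad_lt <;> assumption
  · apply h.swap_middle.intrinsicRad_lt <;> first | assumption | exact Ne.symm ‹_› | linarith
  · apply h.swap_right.swap_middle.intrinsicRad_lt <;>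
      first | assumption | exact Ne.symm ‹_› | linarith
  · apply h.swap_left.swap_middle.intrinsicRad_lt <;>
      first | assumption | exact Ne.symm ‹_› | linarith
  · apply h.swap_left.swap_right.swap_middle.intrinsicRad_lt <;>
      first | assumption | exact Ne.symm ‹_› | linarith
  · apply h.swap_middle.swap_right.swap_left.swap_middle.intrinsicRad_lt <;>
      first | assumption | exact Ne.symm ‹_› | linarith
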